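/- arXiv:2207.07770 — 2 statements merged into one kernel-verified Lean document; each statement's English description precedes it below -/
import Mathlib

section
/- Let k be an algebraically closed field of characteristic zero. For d ≥ 0 let H_d denote the k-vector space of homogeneous polynomials of degree d in k[x₁,x₂,x₃,x₄], with GL₄(k) acting by linear substitutions: (g•f)(x) := f(g⁻¹x). Let Φ : ⋀⁴H₂ → H₄ be the linear map determined by the alternating multilinear map sending (Q₁,Q₂,Q₃,Q₄) to the Jacobian determinant det(∂Qᵢ/∂xⱼ)_{i,j}; it satisfies Φ(g•ω) = det(g)⁻¹·(g•Φ(ω)). Then any linear map Φ' : ⋀⁴H₂ → H₄ satisfying Φ'(g•ω) = det(g)⁻¹·(g•Φ'(ω)) for all g ∈ GL₄(k) and ω ∈ ⋀⁴H₂ is a scalar multiple of Φ. -/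
open MvPolynomial

noncomputable section

/-- The substitution action of `GL₄(k)` on polynomials: `(g • f)(x) = f(g⁻¹x)`. -/
def glAct {k : Type*} [Field k] (g : GL (Fin 4) k) :
    MvPolynomial (Fin 4) k →ₐ[k] MvPolynomial (Fin 4) k :=
  aeval fun i => ∑ j, C ((↑(g⁻¹) : Matrix (Fin 4) (Fin 4) k) i j) * X j

/-- The Jacobian determinant `det(∂Qᵢ/∂xⱼ)` of a 4-tuple of polynomials; for
quadratic forms this is the coordinate form of the natural map
`Φ : ⋀⁴(S²V*) → det(V*) ⊗ S⁴(V*)`. -/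
def jacDet {k : Type*} [Field k] (Q : Fin 4 → MvPolynomial (Fin 4) k) :
    MvPolynomial (Fin 4) k :=
  Matrix.det (Matrix.of fun i j => pderiv j (Q i))

section Substitution

variable {k : Type*} [Field k]

lemma glAct_X (g : GL (Fin 4) k) (i : Fin 4) :
    glAct g (X i) = ∑ j, C ((↑(g⁻¹) : Matrix (Fin 4) (Fin 4) k) i j) * X j :=
  aeval_X _ _

lemma isHomogeneous_glAct (g : GL (Fin 4) k) {f : MvPolynomial (Fin 4) k} {n : ℕ}
    (hf : f.IsHomogeneous n) : (glAct g f).IsHomogeneous n := by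
  have h := hf.aeval (fun i => ∑ j, C ((↑(g⁻¹) : Matrix (Fin 4) (Fin 4) k) i j) * X j)
    (n := 1) fun i => IsHomogeneous.sum _ _ _ fun j _ => isHomogeneous_C_mul_X _ _
  rwa [one_mul] at h

lemma eval_glAct (g : GL (Fin 4) k) (v : Fin 4 → k) (f : MvPolynomial (Fin 4) k) :
    eval v (glAct g f) = eval ((↑(g⁻¹) : Matrix (Fin 4) (Fin 4) k).mulVec v) f := by
  induction f using MvPolynomial.induction_on with
  | C a => simp [glAct]
  | add p q hp hq => simp [hp, hq]
  | mul_X p i hp => simp [hp, glAct_X, Matrix.mulVec, dotProduct]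

/-- The chain rule for a linear substitution. -/
lemma pderiv_glAct (g : GL (Fin 4) k) (j : Fin 4) (f : MvPolynomial (Fin 4) k) :
    pderiv j (glAct g f) =
      ∑ i, glAct g (pderiv i f) * C ((↑(g⁻¹) : Matrix (Fin 4) (Fin 4) k) i j) := by
  induction f using MvPolynomial.induction_on with
  | C a => simp [glAct]
  | add p q hp hq => simp [hp, hq, add_mul, Finset.sum_add_distrib]
  | mul_X p i hp =>
    have hX : pderiv j (glAct g (X i)) = C ((↑(g⁻¹) : Matrix (Fin 4) (Fin 4) k) i j) := by
      simp [glAct_X, pderiv_X, Pi.single_apply]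
    simp only [map_mul, Derivation.leibniz, hX, hp, smul_eq_mul, map_add, add_mul,
      Finset.sum_add_distrib, pderiv_X, Finset.mul_sum]
    refine congrArg₂ (· + ·) ?_ ?_
    · rw [Finset.sum_eq_single i (fun b _ hb => by simp [hb.symm]) (by simp)]
      simp
    · exact Finset.sum_congr rfl fun l _ => by ring

lemma jacDet_glAct (g : GL (Fin 4) k) (Q : Fin 4 → MvPolynomial (Fin 4) k) :
    jacDet (fun l => glAct g (Q l)) =
      ((↑g : Matrix (Fin 4) (Fin 4) k).det)⁻¹ • glAct g (jacDet Q) := by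
  have hmul : (Matrix.of fun i j => pderiv j (glAct g (Q i))) =
      (glAct g).mapMatrix (Matrix.of fun i j => pderiv j (Q i)) *
        C.mapMatrix (↑(g⁻¹) : Matrix (Fin 4) (Fin 4) k) := by
    ext1 i j
    simp [Matrix.mul_apply, pderiv_glAct]
  have hdet : (↑(g⁻¹) : Matrix (Fin 4) (Fin 4) k).det =
      ((↑g : Matrix (Fin 4) (Fin 4) k).det)⁻¹ := by
    rw [Matrix.coe_units_inv, Matrix.det_nonsing_inv, Ring.inverse_eq_inv']
  rw [jacDet, jacDet, hmul, Matrix.det_mul, ← AlgHom.map_det, ← RingHom.map_det, hdet,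
    smul_eq_C_mul, mul_comm]

/-- The Jacobian determinant as an alternating map over the base field. -/
def jacDetAlternating (k : Type*) [Field k] :
    MvPolynomial (Fin 4) k [⋀^Fin 4]→ₗ[k] MvPolynomial (Fin 4) k :=
  AlternatingMap.compLinearMap
    { (Matrix.detRowAlternating (n := Fin 4)
        (R := MvPolynomial (Fin 4) k)).toMultilinearMap.restrictScalars k with
      map_eq_zero_of_eq' := fun v _ _ h hij =>
        (Matrix.detRowAlternating (n := Fin 4)
          (R := MvPolynomial (Fin 4) k)).map_eq_zero_of_eq v h hij }
    (LinearMap.pi fun j => (pderiv j).toLinearMap)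

lemma isHomogeneous_jacDet {Q : Fin 4 → MvPolynomial (Fin 4) k}
    (hQ : ∀ l, (Q l).IsHomogeneous 2) : (jacDet Q).IsHomogeneous 4 := by
  rw [jacDet, Matrix.det_apply]
  refine IsHomogeneous.sum _ _ _ fun σ _ => ?_
  rw [Units.smul_def, zsmul_eq_mul, ← map_intCast (C (σ := Fin 4) (R := k))]
  have h := IsHomogeneous.prod Finset.univ
    (fun i => (Matrix.of fun i j => pderiv j (Q i)) (σ i) i) (fun _ => 1)
    fun i _ => (hQ (σ i)).pderiv
  rw [Finset.sum_const, Finset.card_univ, Fintype.card_fin, smul_eq_mul, mul_one] at h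
  exact h.C_mul _

lemma glAct_monomial_of_inv_eq_diagonal {g : GL (Fin 4) k} {t : Fin 4 → k}
    (hg : (↑(g⁻¹) : Matrix (Fin 4) (Fin 4) k) = Matrix.diagonal t) (d : Fin 4 →₀ ℕ) :
    glAct g (monomial d 1) = (∏ i, t i ^ d i) • monomial d 1 := by
  have hX (i : Fin 4) : glAct g (X i) = C (t i) * X i := by
    rw [glAct_X, hg, Finset.sum_eq_single i (fun j _ hj => by simp [hj.symm]) (by simp)]
    simp
  rw [← one_smul k (monomial d 1), monomial_eq, C_1, one_mul,
    Finsupp.prod_fintype _ _ (by simp)]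
  simp [hX, mul_pow, Finset.prod_mul_distrib, smul_eq_C_mul]

end Substitution

section Weights

/-- The exponent of the monomial `x₀ xⱼ`. -/
def topExponent (j : Fin 4) : Fin 4 →₀ ℕ := Finsupp.single 0 1 + Finsupp.single j 1

lemma degree_topExponent (j : Fin 4) : (topExponent j).degree = 2 := by
  simp [topExponent]

lemma exists_eq_topExponent {d : Fin 4 →₀ ℕ} (hd : d.degree = 2) (h0 : d 0 ≠ 0) :
    ∃ j, d = topExponent j := by
  have hle : Finsupp.single 0 1 ≤ d := by
    simpa [Finsupp.single_le_iff] using Nat.one_le_iff_ne_zero.2 h0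
  obtain ⟨e, rfl⟩ := exists_add_of_le hle
  have he : e.degree = 1 := by
    rw [map_add, Finsupp.degree_single] at hd
    omega
  obtain ⟨j, rfl⟩ := (Finsupp.sum_eq_one_iff e).1 he
  exact ⟨j, rfl⟩

/-- The weight `(5, 1, 1, 1)` of the fourth exterior power of the quadratic forms is spanned by
`x₀² ∧ x₀x₁ ∧ x₀x₂ ∧ x₀x₃`. -/
lemma exists_perm_of_weight {v : Fin 4 → Fin 4 →₀ ℕ} (hv : Function.Injective v)
    (hdeg : ∀ l, (v l).degree = 2) (h0 : ∑ l, v l 0 = 5) :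
    ∃ σ : Equiv.Perm (Fin 4), v = topExponent ∘ σ := by
  have hsum (l : Fin 4) : v l 0 + v l 1 + v l 2 + v l 3 = 2 := by
    rw [← hdeg l, Finsupp.degree_eq_sum, Fin.sum_univ_four]
  have huniq {l m : Fin 4} (hl : v l 0 = 2) (hm : v m 0 = 2) : l = m := by
    refine hv (Finsupp.ext fun i => ?_)
    have := hsum l
    have := hsum m
    fin_cases i <;> simp <;> omega
  have hne (l : Fin 4) : v l 0 ≠ 0 := by
    intro hl
    have hle (m : Fin 4) : v m 0 ≤ 2 := by
      have := hsum m
      omega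
    have hpair {m n : Fin 4} (hmn : m ≠ n) : v m 0 + v n 0 ≤ 3 := by
      by_contra h
      have := hle m
      have := hle n
      exact hmn (huniq (by omega) (by omega))
    have h01 := hpair (m := 0) (n := 1) (by decide)
    have h02 := hpair (m := 0) (n := 2) (by decide)
    have h03 := hpair (m := 0) (n := 3) (by decide)
    have h12 := hpair (m := 1) (n := 2) (by decide)
    have h13 := hpair (m := 1) (n := 3) (by decide)
    have h23 := hpair (m := 2) (n := 3) (by decide)
    rw [Fin.sum_univ_four] at h0
    fin_cases l <;> simp at hl <;> omega
  choose σ hσ using fun l => exists_eq_topExponent (hdeg l) (hne l)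
  have hinj : Function.Injective σ := fun l m h => hv (by rw [hσ l, hσ m, h])
  exact ⟨Equiv.ofBijective σ (Finite.injective_iff_bijective.1 hinj), funext hσ⟩

end Weights

section Equivariant

variable {k : Type*} [Field k]

/-- The monomial `x ^ d` as a quadratic form. -/
def quadMonomial (k : Type*) [Field k] (d : Fin 4 →₀ ℕ) (hd : d.degree = 2) :
    homogeneousSubmodule (Fin 4) k 2 :=
  ⟨monomial d 1, isHomogeneous_monomial 1 hd⟩

/-- Equivariance of an alternating map on quadratic forms, with a `det⁻¹` twist. -/
def IsTwistedEquivariant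
    (Ψ : (homogeneousSubmodule (Fin 4) k 2) [⋀^Fin 4]→ₗ[k] MvPolynomial (Fin 4) k) : Prop :=
  ∀ (g : GL (Fin 4) k) (Q : Fin 4 → homogeneousSubmodule (Fin 4) k 2)
    (hg : ∀ l, glAct g (Q l : MvPolynomial (Fin 4) k) ∈ homogeneousSubmodule (Fin 4) k 2),
    Ψ (fun l => ⟨glAct g (Q l : MvPolynomial (Fin 4) k), hg l⟩) =
      ((↑g : Matrix (Fin 4) (Fin 4) k).det)⁻¹ • glAct g (Ψ Q)

/-- The projection of polynomials onto their quadratic part. -/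
def quadPart (k : Type*) [Field k] :
    MvPolynomial (Fin 4) k →ₗ[k] homogeneousSubmodule (Fin 4) k 2 :=
  (homogeneousComponent 2).codRestrict _ fun f => homogeneousComponent_isHomogeneous 2 f

lemma quadPart_coe (Q : homogeneousSubmodule (Fin 4) k 2) : quadPart k Q = Q :=
  Subtype.ext ((homogeneousComponent_of_mem Q.2).trans (if_pos rfl))

lemma eval_smul_of_isHomogeneous {f : MvPolynomial (Fin 4) k} {n : ℕ} (hf : f.IsHomogeneous n)
    (a : k) (v : Fin 4 → k) : eval (a • v) f = a ^ n * eval v f := by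
  rw [eval_eq, eval_eq, Finset.mul_sum]
  refine Finset.sum_congr rfl fun d hd => ?_
  have hn : ∑ i ∈ d.support, d i = n := by
    rw [← Finsupp.degree_apply, Finsupp.degree_eq_weight_one]
    exact hf (mem_support_iff.1 hd)
  simp only [Pi.smul_apply, smul_eq_mul, mul_pow, Finset.prod_mul_distrib,
    Finset.prod_pow_eq_pow_sum, hn]
  ring

variable {Ψ : (homogeneousSubmodule (Fin 4) k 2) [⋀^Fin 4]→ₗ[k] MvPolynomial (Fin 4) k}

/-- At the first coordinate vector only tuples of `x₀`-degree `5` contribute. -/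
lemma eval_eq_zero_of_weight_ne [CharZero k]
    (hrange : ∀ Q, (Ψ Q).IsHomogeneous 4) (hequiv : IsTwistedEquivariant Ψ)
    {v : Fin 4 → Fin 4 →₀ ℕ} (hdeg : ∀ l, (v l).degree = 2) (h0 : ∑ l, v l 0 ≠ 5) :
    eval (Pi.single 0 1) (Ψ fun l => quadMonomial k (v l) (hdeg l)) = 0 := by
  set Q := fun l => quadMonomial k (v l) (hdeg l) with hQ
  set t : Fin 4 → k := Function.update 1 0 2 with ht
  have htdet : (Matrix.diagonal t).det = 2 := by
    simp [Matrix.det_diagonal, Fin.prod_univ_four, ht]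
  let A : GL (Fin 4) k := Matrix.GeneralLinearGroup.mkOfDetNeZero (Matrix.diagonal t)
    (by rw [htdet]; exact two_ne_zero)
  have hA : (↑(A⁻¹⁻¹) : Matrix (Fin 4) (Fin 4) k) = Matrix.diagonal t := by
    rw [inv_inv]; rfl
  have hdet : ((↑(A⁻¹) : Matrix (Fin 4) (Fin 4) k).det)⁻¹ = 2 := by
    rw [Matrix.coe_units_inv, Matrix.det_nonsing_inv, Ring.inverse_eq_inv', inv_inv]
    exact htdet
  have h := hequiv A⁻¹ Q fun l => isHomogeneous_glAct _ (Q l).2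
  have hact : (fun l => (⟨glAct A⁻¹ (Q l : MvPolynomial (Fin 4) k),
      isHomogeneous_glAct _ (Q l).2⟩ : homogeneousSubmodule (Fin 4) k 2)) =
      fun l => ((2 : k) ^ v l 0) • Q l := by
    funext l
    refine Subtype.ext ?_
    simp [hQ, quadMonomial, glAct_monomial_of_inv_eq_diagonal hA, Fin.prod_univ_four, ht]
  rw [hact, AlternatingMap.map_smul_univ, hdet] at h
  have he := congrArg (eval (Pi.single 0 1)) h
  have hvec : (Matrix.diagonal t).mulVec (Pi.single 0 1) = (2 : k) • Pi.single 0 1 := by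
    ext i
    fin_cases i <;> simp [Matrix.mulVec_diagonal, ht]
  rw [smul_eval, smul_eval, eval_glAct, hA, hvec, eval_smul_of_isHomogeneous (hrange Q),
    Finset.prod_pow_eq_pow_sum, ← mul_assoc, ← pow_succ'] at he
  by_contra hne
  have hpow := mul_right_cancel₀ hne he
  exact h0 (Nat.pow_right_injective le_rfl (by exact_mod_cast hpow))

/-- A twisted equivariant map is determined by its value on a highest weight vector. -/
lemma eq_zero_of_eval_topExponent [CharZero k]
    (hrange : ∀ Q, (Ψ Q).IsHomogeneous 4) (hequiv : IsTwistedEquivariant Ψ)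
    (htop : eval (Pi.single 0 1)
      (Ψ fun l => quadMonomial k (topExponent l) (degree_topExponent l)) = 0) : Ψ = 0 := by
  have hcomp : ((aeval (R := k) (Pi.single 0 1 : Fin 4 → k)).toLinearMap.compAlternatingMap
      Ψ).compLinearMap (quadPart k) = 0 := by
    refine (basisMonomials (Fin 4) k).ext_alternating fun v hv => ?_
    simp only [coe_basisMonomials, AlternatingMap.compLinearMap_apply,
      LinearMap.compAlternatingMap_apply, AlternatingMap.zero_apply, AlgHom.toLinearMap_apply]
    by_cases hdeg : ∀ l, (v l).degree = 2
    · have hpart : (fun l => quadPart k (monomial (v l) 1)) =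
          fun l => quadMonomial k (v l) (hdeg l) :=
        funext fun l => quadPart_coe (quadMonomial k (v l) (hdeg l))
      change eval _ (Ψ fun l => quadPart k (monomial (v l) 1)) = 0
      rw [hpart]
      by_cases h0 : ∑ l, v l 0 = 5
      · obtain ⟨σ, rfl⟩ := exists_perm_of_weight hv hdeg h0
        have hperm := Ψ.map_perm
          (fun l => quadMonomial k (topExponent l) (degree_topExponent l)) σ
        change Ψ (fun l => quadMonomial k ((topExponent ∘ σ) l) (hdeg l)) = _ at hperm
        rw [hperm, Units.smul_def, map_zsmul, htop, smul_zero]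
      · exact eval_eq_zero_of_weight_ne hrange hequiv hdeg h0
    · push Not at hdeg
      obtain ⟨l, hl⟩ := hdeg
      rw [Ψ.map_coord_zero l, map_zero]
      refine Subtype.ext ?_
      change homogeneousComponent 2 (monomial (v l) 1) = 0
      rw [homogeneousComponent_of_mem (isHomogeneous_monomial 1 rfl), if_neg hl.symm]
  have heval (Q) : eval (Pi.single 0 1) (Ψ Q) = 0 := by
    have h := DFunLike.congr_fun hcomp fun l => (Q l : MvPolynomial (Fin 4) k)
    simpa [quadPart_coe, coe_aeval_eq_eval] using h
  ext1 Q
  refine (mul_eq_zero.1 (MvPolynomial.funext fun w => ?_ : X 0 * Ψ Q = 0)).resolve_left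
    (X_ne_zero 0)
  rw [map_mul, eval_X, map_zero]
  by_cases hw : w 0 = 0
  · rw [hw, zero_mul]
  have hdet : ((1 : Matrix (Fin 4) (Fin 4) k).updateCol 0 w).det ≠ 0 := by
    rwa [← Matrix.cramer_apply, Matrix.cramer_one]
  let A : GL (Fin 4) k := Matrix.GeneralLinearGroup.mkOfDetNeZero _ hdet
  have hA : (↑(A⁻¹⁻¹) : Matrix (Fin 4) (Fin 4) k) = (1 : Matrix _ _ k).updateCol 0 w := by
    rw [inv_inv]; rfl
  have h := congrArg (eval (Pi.single 0 1))
    (hequiv A⁻¹ Q fun l => isHomogeneous_glAct _ (Q l).2)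
  have hcol : ((1 : Matrix (Fin 4) (Fin 4) k).updateCol 0 w).mulVec (Pi.single 0 1) = w := by
    ext i
    simp
  rw [heval, smul_eval, eval_glAct, hA, hcol, eq_comm, mul_eq_zero] at h
  rw [h.resolve_left (inv_ne_zero (A⁻¹).det.ne_zero), mul_zero]

lemma eval_jacDet_topExponent :
    eval (Pi.single 0 1) (jacDet fun l => (monomial (topExponent l) 1 : MvPolynomial (Fin 4) k)) =
      2 := by
  have hmon (l : Fin 4) : (monomial (topExponent l) 1 : MvPolynomial (Fin 4) k) = X 0 * X l := by
    simp [topExponent, X, monomial_mul]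
  simp only [hmon, jacDet, RingHom.map_det]
  rw [Matrix.det_of_isLowerTriangular]
  · simp [Fin.prod_univ_four, pderiv_X, one_add_one_eq_two]
  · intro i j (hij : i < j)
    have hj : (0 : Fin 4) ≠ j := ((Fin.zero_le i).trans_lt hij).ne
    simp [pderiv_X, Pi.single_apply, hij.ne, hj]

end Equivariant

/-- Multiplicity one: any linear map `Φ' : ⋀⁴H₂ → H₄` (presented as an alternating
4-multilinear map on the space `H₂` of homogeneous quadratic forms with values in
homogeneous quartics) which is `GL₄(k)`-equivariant with a `det⁻¹` twist, i.e.
`Φ'(g•ω) = det(g)⁻¹·(g•Φ'(ω))`, is a scalar multiple of the Jacobian determinant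
map `Φ`. -/
theorem multiplicity_one_jacobian {k : Type*} [Field k] [IsAlgClosed k] [CharZero k]
    (Φ' : (↥(homogeneousSubmodule (Fin 4) k 2)) [⋀^Fin 4]→ₗ[k] MvPolynomial (Fin 4) k)
    (hrange : ∀ Q : Fin 4 → ↥(homogeneousSubmodule (Fin 4) k 2),
      (Φ' Q).IsHomogeneous 4)
    (hequiv : ∀ (g : GL (Fin 4) k) (Q : Fin 4 → ↥(homogeneousSubmodule (Fin 4) k 2))
      (hg : ∀ l, glAct g (Q l : MvPolynomial (Fin 4) k) ∈ homogeneousSubmodule (Fin 4) k 2),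
      Φ' (fun l => ⟨glAct g (Q l : MvPolynomial (Fin 4) k), hg l⟩) =
        ((↑g : Matrix (Fin 4) (Fin 4) k).det)⁻¹ • glAct g (Φ' Q)) :
    ∃ c : k, ∀ Q : Fin 4 → ↥(homogeneousSubmodule (Fin 4) k 2),
      Φ' Q = c • jacDet (fun l => (Q l : MvPolynomial (Fin 4) k)) := by
  let J : (homogeneousSubmodule (Fin 4) k 2) [⋀^Fin 4]→ₗ[k] MvPolynomial (Fin 4) k :=
    (jacDetAlternating k).compLinearMap (Submodule.subtype _)
  have hJ (Q) : J Q = jacDet fun l => (Q l : MvPolynomial (Fin 4) k) := rfl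
  let top (l : Fin 4) := quadMonomial k (topExponent l) (degree_topExponent l)
  have htop : eval (Pi.single 0 1) (J top) = 2 := eval_jacDet_topExponent
  obtain ⟨c, hc⟩ : ∃ c, eval (Pi.single 0 1) (Φ' top) = c * 2 :=
    ⟨_, (div_mul_cancel₀ _ two_ne_zero).symm⟩
  have hsub (Q) : (Φ' - c • J) Q =
      Φ' Q - c • jacDet fun l => (Q l : MvPolynomial (Fin 4) k) := rfl
  have hzero : Φ' - c • J = 0 := by
    refine eq_zero_of_eval_topExponent (fun Q => ?_) (fun g Q hg => ?_) ?_
    · rw [hsub, smul_eq_C_mul]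
      exact (hrange Q).sub ((isHomogeneous_jacDet fun l => (Q l).2).C_mul _)
    · rw [hsub, hsub, hequiv g Q hg, jacDet_glAct, map_sub, map_smul, smul_sub, smul_comm c]
    · change eval (Pi.single 0 1) ((Φ' - c • J) top) = 0
      rw [hsub, ← hJ, map_sub, smul_eval, htop, hc, sub_self]
  exact ⟨c, fun Q => sub_eq_zero.1 ((hsub Q).symm.trans (DFunLike.congr_fun hzero Q))⟩
end
end

section
/- Let k be a field of characteristic zero, n ≥ 3, and consider the polynomial ring k[z₁,…,zₙ]. Define the linear bracket {f,g}_lin := Σ_{i=1}^{n−1} zᵢ(∂ᵢf·∂ₙg − ∂ₙf·∂ᵢg) (the linearization Σᵢ xᵢ∂_{xᵢ}∧∂_y of a Feigin–Odesskii bracket at a point of the elliptic curve) and, for constants c_{ab} ∈ k (1 ≤ a < b ≤ n), the constant-coefficient bracket {f,g}_c := Σ_{a<b} c_{ab}(∂ₐf·∂_bg − ∂_bf·∂ₐg). Then the mixed Jacobiator J of {·,·}_lin and {·,·}_c satisfies J(f,g,h)(0) = 0 for all f,g,h ∈ k[z₁,…,zₙ] (vanishing of the constant term) if and only if c_{ab}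 = 0 for all 1 ≤ a < b ≤ n−1, i.e., if and only if the constant bivector Σ c_{ab}∂ₐ∧∂_b is of the form v∧∂ₙ for some vector v. -/
open MvPolynomial

noncomputable section

/-- Mixed Jacobiator of two brackets. -/
def mixedJacobiator {k : Type*} [Field k] {n : ℕ}
    (b₁ b₂ : MvPolynomial (Fin n) k → MvPolynomial (Fin n) k → MvPolynomial (Fin n) k)
    (f g h : MvPolynomial (Fin n) k) : MvPolynomial (Fin n) k :=
  b₂ (b₁ f g) h + b₂ (b₁ g h) f + b₂ (b₁ h f) g +
    b₁ (b₂ f g) h + b₁ (b₂ g h) f + b₁ (b₂ h f) g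

/-- The linear bracket `{f,g} = Σ_{i ≠ last} zᵢ (∂ᵢf ∂_lastg − ∂_lastf ∂ᵢg)`,
the linearization `Σᵢ xᵢ ∂_{xᵢ} ∧ ∂_y` of a Feigin–Odesskii bracket at a point of
the elliptic curve. -/
def linBracket {k : Type*} [Field k] {n : ℕ} (last : Fin n)
    (f g : MvPolynomial (Fin n) k) : MvPolynomial (Fin n) k :=
  ∑ i ∈ Finset.univ.erase last,
    X i * (pderiv i f * pderiv last g - pderiv last f * pderiv i g)

/-- The constant-coefficient bracket `{f,g} = Σ_{a<b} c_{ab} (∂ₐf ∂_bg − ∂_bf ∂ₐg)`. -/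
def constBracket {k : Type*} [Field k] {n : ℕ} (c : Fin n → Fin n → k)
    (f g : MvPolynomial (Fin n) k) : MvPolynomial (Fin n) k :=
  ∑ a : Fin n, ∑ b : Fin n,
    if a < b then C (c a b) * (pderiv a f * pderiv b g - pderiv b f * pderiv a g) else 0

theorem eval_zero_linBracket {k : Type*} [Field k] {n : ℕ} (last : Fin n)
    (f g : MvPolynomial (Fin n) k) : eval (0 : Fin n → k) (linBracket last f g) = 0 := by
  simp [linBracket]

theorem eval_zero_pderiv_linBracket {k : Type*} [Field k] {n : ℕ} (last a : Fin n)
    (f g : MvPolynomial (Fin n) k) :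
    eval (0 : Fin n → k) (pderiv a (linBracket last f g)) =
      if a = last then 0 else
        eval 0 (pderiv a f) * eval 0 (pderiv last g) -
          eval 0 (pderiv last f) * eval 0 (pderiv a g) := by
  simp [linBracket, Derivation.leibniz, pderiv_X, Pi.single_apply, apply_ite]
  rintro rfl
  ring

theorem eval_pderiv_X {k : Type*} [Field k] {n : ℕ} (x : Fin n → k) (i j : Fin n) :
    eval x (pderiv i (X j)) = if j = i then 1 else 0 := by
  simp [pderiv_X, Pi.single_apply, apply_ite (eval x)]

theorem eval_constBracket {k : Type*} [Field k] {n : ℕ} (c : Fin n → Fin n → k) (x : Fin n → k)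
    (f g : MvPolynomial (Fin n) k) :
    eval x (constBracket c f g) = ∑ a, ∑ b, if a < b then
      c a b * (eval x (pderiv a f) * eval x (pderiv b g) -
        eval x (pderiv b f) * eval x (pderiv a g)) else 0 := by
  simp [constBracket, apply_ite (eval x)]

/-- Only the terms whose outer bracket is the constant one contribute at the origin. -/
theorem eval_zero_mixedJacobiator {k : Type*} [Field k] {n : ℕ} (last : Fin n)
    (c : Fin n → Fin n → k) (f g h : MvPolynomial (Fin n) k) :
    eval (0 : Fin n → k) (mixedJacobiator (linBracket last) (constBracket c) f g h) =
      eval 0 (constBracket c (linBracket last f g) h) +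
        eval 0 (constBracket c (linBracket last g h) f) +
        eval 0 (constBracket c (linBracket last h f) g) := by
  simp only [mixedJacobiator, map_add, eval_zero_linBracket, add_zero]

/-- The value of the mixed Jacobiator on coordinate functions picks out `2 * c a b`. -/
theorem eval_zero_mixedJacobiator_X {k : Type*} [Field k] {n : ℕ} {last a b : Fin n}
    (c : Fin n → Fin n → k) (hab : a < b) (ha : a ≠ last) (hb : b ≠ last) :
    eval (0 : Fin n → k)
      (mixedJacobiator (linBracket last) (constBracket c) (X a) (X last) (X b)) = 2 * c a b := by
  rw [eval_zero_mixedJacobiator]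
  simp only [eval_constBracket, ← Finset.sum_add_distrib, eval_zero_pderiv_linBracket,
    eval_pderiv_X]
  rw [Finset.sum_eq_single a, Finset.sum_eq_single b]
  · simp only [hab, ha, hb, hab.ne, hab.ne', ha.symm, hb.symm, if_true, if_false]
    ring
  · intro j _ hj
    grind
  · simp
  · intro i _ hi
    refine Finset.sum_eq_zero fun j _ => ?_
    grind
  · simp

/-- The constant term of the mixed Jacobiator of the linear bracket
`Σ_{i<n} zᵢ ∂ᵢ ∧ ∂ₙ` and a constant-coefficient bracket `Σ_{a<b} c_{ab} ∂ₐ ∧ ∂_b`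
vanishes for all polynomials iff `c_{ab} = 0` whenever `a < b ≤ n−1`, i.e. iff the
constant bivector is of the form `v ∧ ∂ₙ`. -/
theorem linearization_constraint {k : Type*} [Field k] [CharZero k]
    (n : ℕ) (hn : 3 ≤ n) (c : Fin n → Fin n → k) :
    (∀ f g h : MvPolynomial (Fin n) k,
        eval (0 : Fin n → k)
          (mixedJacobiator (linBracket (⟨n - 1, by omega⟩ : Fin n)) (constBracket c) f g h)
          = 0) ↔
      ∀ a b : Fin n, a < b → b ≠ (⟨n - 1, by omega⟩ : Fin n) → c a b = 0 := by
  have hlast : ∀ a : Fin n, a ≤ ⟨n - 1, by omega⟩ := fun a => Nat.le_sub_one_of_lt a.isLt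
  generalize (⟨n - 1, _⟩ : Fin n) = last at hlast ⊢
  constructor
  · intro H a b hab hb
    have hJ := H (X a) (X last) (X b)
    rw [eval_zero_mixedJacobiator_X c hab (hab.trans_le (hlast b)).ne hb] at hJ
    simpa using hJ
  · intro H f g h
    simp only [eval_zero_mixedJacobiator, eval_constBracket, ← Finset.sum_add_distrib]
    refine Finset.sum_eq_zero fun a _ => Finset.sum_eq_zero fun b _ => ?_
    by_cases hab : a < b
    · by_cases hb : b = last
      · subst hb
        simp only [if_pos hab, eval_zero_pderiv_linBracket, if_neg hab.ne, if_true]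
        ring
      · simp [H a b hab hb]
    · simp [hab]
end
end
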